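/- Let 0 → H → F → Q → 0 be an exact sequence of coherent sheaves on a noetherian integral Cohen–Macaulay scheme X. Suppose F is reflexive, H and Q** are locally free, and Q is locally free in codimension 2. Then F and Q are locally free. -/

import Mathlib

/-!
STATEMENT 3. Let `0 → H → F → Q → 0` be an exact sequence of coherent sheaves on a
noetherian integral Cohen–Macaulay scheme `X`.  Suppose `F` is reflexive, `H` and `Q**`
are locally free, and `Q` is locally free in codimension 2.  Then `F` and `Q` are
locally free.

Affine-local commutative algebra formalization: `R` is a Noetherian Cohen–Macaulay
domain.  Cohen–Macaulayness is expressed by: for every prime `p`, the localization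
`R_p` contains a regular sequence inside its maximal ideal of length the height of `p`.
Coherent sheaves are finitely generated modules; "locally free" for finitely generated
modules over a Noetherian ring is `Module.Projective`; "locally free in codimension 2"
means free after localization at every prime of height ≤ 2. -/

/-- A Noetherian ring is Cohen–Macaulay if, for every prime `p`, the local ring `R_p`
admits a regular sequence contained in its maximal ideal whose length is the height
of `p`. -/
def IsCohenMacaulayRing (R : Type*) [CommRing R] : Prop :=
  ∀ p : PrimeSpectrum R, ∃ rs : List (Localization.AtPrime p.asIdeal),
    (∀ r ∈ rs, r ∈ IsLocalRing.maximalIdeal (Localization.AtPrime p.asIdeal)) ∧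
    RingTheory.Sequence.IsRegular (Localization.AtPrime p.asIdeal) rs ∧
    (rs.length : ℕ∞) = Order.height p

/-- If `Q` is projective after localizing at `S`, any functional on `H` extends to `F`, up to a
multiple in `S`. -/
theorem exists_smul_eq_comp_of_projective_localizedModule
    {R : Type*} [CommRing R] [IsNoetherianRing R] (S : Submonoid R)
    (hS : S ≤ nonZeroDivisors R)
    {H F Q : Type*} [AddCommGroup H] [Module R H]
    [AddCommGroup F] [Module R F] [Module.Finite R F] [AddCommGroup Q] [Module R Q]
    (α : H →ₗ[R] F) (β : F →ₗ[R] Q)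
    (hinj : Function.Injective α) (hsurj : Function.Surjective β) (hexact : Function.Exact α β)
    [Module.Projective (Localization S) (LocalizedModule S Q)] (d : Module.Dual R H) :
    ∃ s ∈ S, ∃ f : Module.Dual R F, f ∘ₗ α = s • d := by
  let mH := LocalizedModule.mkLinearMap S H
  let mF := LocalizedModule.mkLinearMap S F
  let mQ := LocalizedModule.mkLinearMap S Q
  let α' := (IsLocalizedModule.map S mH mF α).extendScalarsOfIsLocalization S (Localization S)
  let β' := (IsLocalizedModule.map S mF mQ β).extendScalarsOfIsLocalization S (Localization S)
  have hα' : Function.Injective α' := IsLocalizedModule.map_injective S mH mF α hinj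
  have hβ' : Function.Surjective β' := IsLocalizedModule.map_surjective S mF mQ β hsurj
  have hex : Function.Exact α' β' := IsLocalizedModule.map_exact S mH mF mQ α β hexact
  obtain ⟨σ, hσ⟩ := Module.projective_lifting_property β' .id hβ'
  obtain ⟨-, r, hr⟩ : Function.Surjective β' ∧ ∃ l, l ∘ₗ α' = .id :=
    (hex.split_tfae'.out 0 1 rfl rfl).mp ⟨hα', σ, hσ⟩
  let d' := IsLocalizedModule.map S mH (Algebra.linearMap R (Localization S)) d
  have : Module.FinitePresentation R F := Module.finitePresentation_of_finite R F
  obtain ⟨f, s, hf⟩ := Module.FinitePresentation.exists_lift_of_isLocalizedModule S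
    (Algebra.linearMap R (Localization S)) (d' ∘ₗ r.restrictScalars R ∘ₗ mF)
  refine ⟨s, s.2, f, LinearMap.ext fun h ↦ IsLocalization.injective (Localization S) hS ?_⟩
  have h₁ : mF (α h) = α' (mH h) := (IsLocalizedModule.map_apply S mH mF α h).symm
  have h₂ : r (α' (mH h)) = mH h := LinearMap.congr_fun hr _
  have h₃ : d' (mH h) = algebraMap R _ (d h) := IsLocalizedModule.map_apply S mH _ d h
  have h₄ := LinearMap.congr_fun hf (α h)
  simp only [LinearMap.comp_apply, LinearMap.smul_apply, LinearMap.restrictScalars_apply, h₁, h₂,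
    h₃, Algebra.linearMap_apply, Submonoid.smul_def] at h₄
  simpa [Algebra.smul_def] using h₄

/-- Elementwise form of regularity for the first three members of a weakly regular sequence. -/
theorem RingTheory.Sequence.IsWeaklyRegular.exists_first_three
    {A : Type*} [CommRing A] {rs : List A} (h : IsWeaklyRegular A rs) (hlen : 3 ≤ rs.length) :
    ∃ a ∈ rs, ∃ b ∈ rs, ∃ c ∈ rs, IsSMulRegular A a ∧
      (∀ x y, a * x = b * y → a ∣ y) ∧
      (∀ x y z, c * z = a * x + b * y → ∃ u v, z = a * u + b * v) := by
  obtain ⟨a, b, c, l, rfl⟩ : ∃ a b c l, rs = a :: b :: c :: l := by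
    match rs, hlen with
    | a :: b :: c :: l, _ => exact ⟨a, b, c, l, rfl⟩
  refine ⟨a, by simp, b, by simp, c, by simp, ((isWeaklyRegular_cons_iff _ _ _).1 h).1, ?_, ?_⟩
  · intro x y hxy
    have := mem_of_isSMulRegular_quotient_of_smul_mem (h.regular_mod_prev 1 (by simp)) (x := y)
    simp only [List.take_succ_cons, List.take_zero, List.getElem_cons_succ, List.getElem_cons_zero,
      Ideal.ofList_singleton, smul_eq_mul, Ideal.mul_top, Ideal.mem_span_singleton] at this
    exact this ⟨x, hxy.symm⟩
  · intro x y z hz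
    have := mem_of_isSMulRegular_quotient_of_smul_mem (h.regular_mod_prev 2 (by simp)) (x := z)
    simp only [List.take_succ_cons, List.take_zero, List.getElem_cons_succ, List.getElem_cons_zero,
      Ideal.ofList_cons, Ideal.ofList_nil, sup_bot_eq, smul_eq_mul, Ideal.mul_top,
      ← Ideal.span_insert, Ideal.mem_span_pair] at this
    obtain ⟨u, v, huv⟩ := this ⟨x, y, by rw [hz]; ring⟩
    exact ⟨u, v, by rw [← huv]; ring⟩

/-- At a prime of height at least three, a Cohen–Macaulay domain has three elements of the prime
which form a regular sequence after localization, with the denominators made explicit. -/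
theorem IsCohenMacaulayRing.exists_regular_triple
    {R : Type*} [CommRing R] [IsDomain R] (hCM : IsCohenMacaulayRing R)
    (p : PrimeSpectrum R) (hp : 2 < Order.height p) :
    ∃ a ∈ p.asIdeal, ∃ b ∈ p.asIdeal, ∃ c ∈ p.asIdeal, a ≠ 0 ∧
      (∀ x y, a * x = b * y → ∃ s ∉ p.asIdeal, a ∣ s * y) ∧
      (∀ x y z, c * z = a * x + b * y → ∃ s ∉ p.asIdeal, ∃ u v, s * z = a * u + b * v) := by
  obtain ⟨rs, hmem, hreg, hlen⟩ := hCM p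
  have hlen' : 3 ≤ rs.length := by
    rw [← hlen] at hp
    exact_mod_cast hp
  obtain ⟨a, ha, b, hb, c, hc, h₁, h₂, h₃⟩ := hreg.toIsWeaklyRegular.exists_first_three hlen'
  let A := Localization.AtPrime p.asIdeal
  have hinj : Function.Injective (algebraMap R A) :=
    IsLocalization.injective A p.asIdeal.primeCompl_le_nonZeroDivisors
  have key : ∀ x ∈ rs, ∃ r ∈ p.asIdeal, ∃ w : Aˣ, algebraMap R A r = w * x := by
    intro x hx
    obtain ⟨⟨r, s⟩, hrs⟩ := IsLocalization.surj p.asIdeal.primeCompl x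
    refine ⟨r, ?_, (IsLocalization.map_units A s).unit, by simpa [mul_comm] using hrs.symm⟩
    rw [← IsLocalization.AtPrime.to_map_mem_maximal_iff A p.asIdeal, ← hrs]
    exact Ideal.mul_mem_right _ _ (hmem x hx)
  obtain ⟨a', ha', wa, hwa⟩ := key a ha
  obtain ⟨b', hb', wb, hwb⟩ := key b hb
  obtain ⟨c', hc', wc, hwc⟩ := key c hc
  refine ⟨a', ha', b', hb', c', hc', ?_, ?_, ?_⟩
  · rintro rfl
    have : a = 0 := by simpa using hwa.symm
    subst this
    exact one_ne_zero (h₁ (show (0 : A) • (1 : A) = (0 : A) • 0 by simp))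
  · intro x y hxy
    have e : a * (wa * algebraMap R A x) = b * (wb * algebraMap R A y) := by
      have := congrArg (algebraMap R A) hxy
      rw [map_mul, map_mul, hwa, hwb] at this
      linear_combination this
    obtain ⟨t, ht⟩ := h₂ _ _ e
    obtain ⟨⟨r, s⟩, hrs⟩ := IsLocalization.surj p.asIdeal.primeCompl (↑wb⁻¹ * ↑wa⁻¹ * t)
    refine ⟨s, s.2, r, hinj ?_⟩
    simp only [map_mul, hwa]
    dsimp only at hrs
    have e₁ : (wb : A) * ↑wb⁻¹ = 1 := wb.mul_inv
    have e₂ : (wa : A) * ↑wa⁻¹ = 1 := wa.mul_inv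
    rw [← hrs]
    calc _ = algebraMap R A s * ↑wb⁻¹ * (wb * algebraMap R A y) := by
          linear_combination (-algebraMap R A s * algebraMap R A y) * e₁
      _ = _ := by rw [ht]; linear_combination (-algebraMap R A s * ↑wb⁻¹ * a * t) * e₂
  · intro x y z hz
    have e : c * (wc * algebraMap R A z) =
        a * (wa * algebraMap R A x) + b * (wb * algebraMap R A y) := by
      have := congrArg (algebraMap R A) hz
      rw [map_add, map_mul, map_mul, map_mul, hwa, hwb, hwc] at this
      linear_combination this
    obtain ⟨u, v, huv⟩ := h₃ _ _ _ e
    obtain ⟨⟨u', s⟩, hu⟩ := IsLocalization.surj p.asIdeal.primeCompl (↑wc⁻¹ * ↑wa⁻¹ * u)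
    obtain ⟨⟨v', t⟩, hv⟩ := IsLocalization.surj p.asIdeal.primeCompl (↑wc⁻¹ * ↑wb⁻¹ * v)
    refine ⟨(s * t : p.asIdeal.primeCompl), (s * t).2, u' * t, v' * s, hinj ?_⟩
    dsimp only at hu hv
    simp only [map_mul, map_add, hwa, hwb, Submonoid.coe_mul]
    have e₁ : (wc : A) * ↑wc⁻¹ = 1 := wc.mul_inv
    have e₂ : (wa : A) * ↑wa⁻¹ = 1 := wa.mul_inv
    have e₃ : (wb : A) * ↑wb⁻¹ = 1 := wb.mul_inv
    generalize algebraMap R A s = s at *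
    generalize algebraMap R A t = t at *
    calc _ = s * t * ↑wc⁻¹ * (wc * algebraMap R A z) := by
          linear_combination (-s * t * algebraMap R A z) * e₁
      _ = _ := by
        rw [huv]
        linear_combination (-s * t * ↑wc⁻¹ * a * u) * e₂ + (-s * t * ↑wc⁻¹ * b * v) * e₃ +
          t * a * wa * hu + s * b * wb * hv

/-- Denominators for finitely many elements can be chosen uniformly. -/
theorem Ideal.IsPrime.exists_notMem_forall_of_dvd_closed
    {R ι : Type*} [CommRing R] [Finite ι] {p : Ideal R} (hp : p.IsPrime) {P : ι → R → Prop}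
    (hmul : ∀ i s t, P i s → P i (t * s)) (h : ∀ i, ∃ s ∉ p, P i s) :
    ∃ s ∉ p, ∀ i, P i s := by
  classical
  have := Fintype.ofFinite ι
  choose s hs hP using h
  refine ⟨∏ i, s i, ?_, fun i ↦ ?_⟩
  · rw [hp.prod_mem_iff]
    rintro ⟨i, -, hi⟩
    exact hs i hi
  · rw [← Finset.prod_erase_mul _ _ (Finset.mem_univ i)]
    exact hmul _ _ _ (hP i)

/-- A relation of divisibility modulo two elements passes from a ring to its finite projective
modules. -/
theorem exists_smul_eq_smul_add_smul_of_projective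
    {R M : Type*} [CommRing R] [AddCommGroup M] [Module R M] [Module.Finite R M]
    [Module.Projective R M] {p : Ideal R} (hp : p.IsPrime) {a b c : R}
    (h : ∀ x y z, c * z = a * x + b * y → ∃ s ∉ p, ∃ u v, s * z = a * u + b * v)
    {x y z : M} (hz : c • z = a • x + b • y) :
    ∃ s ∉ p, ∃ u v : M, s • z = a • u + b • v := by
  obtain ⟨n, f, g, -, -, hfg⟩ := Module.Finite.exists_comp_eq_id_of_projective R M
  obtain ⟨s, hs, hsz⟩ := hp.exists_notMem_forall_of_dvd_closed
    (P := fun i s ↦ ∃ u v, s * g z i = a * u + b * v)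
    (fun i s t ⟨u, v, huv⟩ ↦ ⟨t * u, t * v, by linear_combination t * huv⟩)
    (fun i ↦ h (g x i) (g y i) (g z i) (by simpa using congrFun (congrArg g hz) i))
  choose u v huv using hsz
  refine ⟨s, hs, f u, f v, ?_⟩
  have : s • g z = a • u + b • v := funext huv
  have h₂ := congrArg f this
  simp only [map_smul, map_add] at h₂
  rwa [show f (g z) = z from LinearMap.congr_fun hfg z] at h₂

/-- Divisibility in a domain, valid locally at a prime, passes to functionals on a finite module. -/
theorem Module.Dual.exists_smul_eq_smul
    {R M : Type*} [CommRing R] [IsDomain R] [AddCommGroup M] [Module R M] [Module.Finite R M]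
    {p : Ideal R} (hp : p.IsPrime) {a b : R} (ha : a ≠ 0)
    (h : ∀ x y, a * x = b * y → ∃ s ∉ p, a ∣ s * y)
    {f g : Module.Dual R M} (hfg : a • f = b • g) :
    ∃ s ∉ p, ∃ k : Module.Dual R M, s • g = a • k := by
  obtain ⟨n, e, he⟩ := Module.Finite.exists_fin (R := R) (M := M)
  obtain ⟨s, hs, hsg⟩ := hp.exists_notMem_forall_of_dvd_closed
    (P := fun i s ↦ a ∣ s * g (e i))
    (fun i s t hst ↦ by rw [mul_assoc]; exact hst.mul_left t)
    (fun i ↦ h (f (e i)) (g (e i)) (LinearMap.congr_fun hfg (e i)))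
  have hall : ∀ m, ∃ k, a * k = s * g m := by
    intro m
    have hm : m ∈ Submodule.span R (Set.range e) := he ▸ Submodule.mem_top
    have : Submodule.span R (Set.range e) ≤
        Submodule.comap (s • g) (Ideal.span {a} : Ideal R) := by
      rw [Submodule.span_le]
      rintro _ ⟨i, rfl⟩
      exact Ideal.mem_span_singleton.2 (hsg i)
    obtain ⟨k, hk⟩ := Ideal.mem_span_singleton.1 (this hm)
    exact ⟨k, hk.symm⟩
  choose k hk using hall
  refine ⟨s, hs, ⟨⟨k, fun x y ↦ mul_left_cancel₀ ha ?_⟩, fun r x ↦ mul_left_cancel₀ ha ?_⟩,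
    LinearMap.ext fun m ↦ (hk m).symm⟩
  · rw [mul_add, hk, hk, hk, map_add, mul_add]
  · simp only [hk, map_smul, smul_eq_mul, RingHom.id_apply]
    rw [mul_left_comm, mul_left_comm a, hk]

/-- The dual of a module is a direct summand of its triple dual. -/
theorem Module.Dual.projective_of_projective_dual_dual
    {R M : Type*} [CommRing R] [AddCommGroup M] [Module R M]
    [Module.Finite R (Module.Dual R (Module.Dual R M))]
    [Module.Projective R (Module.Dual R (Module.Dual R M))] :
    Module.Projective R (Module.Dual R M) :=
  .of_split (Module.Dual.eval R (Module.Dual R M)) (Module.Dual.eval R M).dualMap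
    (LinearMap.ext fun _ ↦ rfl)

/-- Over a Cohen–Macaulay domain, if `Q` is free in codimension two and has projective dual, then
every functional on `H` extends to `F`. -/
theorem IsCohenMacaulayRing.dualMap_surjective
    {R : Type*} [CommRing R] [IsDomain R] [IsNoetherianRing R] (hCM : IsCohenMacaulayRing R)
    {H F Q : Type*} [AddCommGroup H] [Module R H]
    [AddCommGroup F] [Module R F] [Module.Finite R F]
    [AddCommGroup Q] [Module R Q] [Module.Finite R Q]
    {α : H →ₗ[R] F} {β : F →ₗ[R] Q}
    (hinj : Function.Injective α) (hsurj : Function.Surjective β) (hexact : Function.Exact α β)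
    [Module.Projective R (Module.Dual R Q)]
    (hQ : ∀ p : PrimeSpectrum R, Order.height p ≤ 2 →
      Module.Free (Localization.AtPrime p.asIdeal)
        (LocalizedModule p.asIdeal.primeCompl Q)) :
    Function.Surjective α.dualMap := by
  rw [← LinearMap.range_eq_top]
  by_contra hne
  have : Nontrivial (Module.Dual R H ⧸ LinearMap.range α.dualMap) :=
    Submodule.Quotient.nontrivial_iff.2 hne
  obtain ⟨P, hP⟩ := associatedPrimes.nonempty R (Module.Dual R H ⧸ LinearMap.range α.dualMap)
  obtain ⟨hprime, x, hx⟩ := isAssociatedPrime_iff.1 hP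
  obtain ⟨d, rfl⟩ := Submodule.Quotient.mk_surjective _ x
  have hmem : ∀ r, r ∈ P ↔ ∃ f : Module.Dual R F, f ∘ₗ α = r • d := by
    intro r
    rw [hx, Submodule.mem_colon_singleton, Submodule.mem_bot, ← Submodule.Quotient.mk_smul,
      Submodule.Quotient.mk_eq_zero]
    rfl
  let p : PrimeSpectrum R := ⟨P, hprime⟩
  have hker : ∀ g : Module.Dual R F, g ∘ₗ α = 0 → ∃ q : Module.Dual R Q, q ∘ₗ β = g := by
    exact fun g hg ↦ (LinearMap.exact_lcomp_of_exact_of_surjective R hexact hsurj g).1 hg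
  rcases le_or_gt (Order.height p) 2 with hle | hgt
  · have := hQ p hle
    obtain ⟨s, hs, f, hf⟩ := exists_smul_eq_comp_of_projective_localizedModule
      p.asIdeal.primeCompl p.asIdeal.primeCompl_le_nonZeroDivisors α β hinj hsurj hexact d
    exact hs ((hmem s).2 ⟨f, hf⟩)
  · obtain ⟨a, ha, b, hb, c, hc, ha₀, hab, habc⟩ := hCM.exists_regular_triple p hgt
    obtain ⟨fa, hfa⟩ := (hmem a).1 ha
    obtain ⟨fb, hfb⟩ := (hmem b).1 hb
    obtain ⟨fc, hfc⟩ := (hmem c).1 hc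
    obtain ⟨qab, hqab⟩ := hker (a • fb - b • fa) (by
      rw [LinearMap.sub_comp, LinearMap.smul_comp, LinearMap.smul_comp, hfa, hfb]; module)
    obtain ⟨qac, hqac⟩ := hker (a • fc - c • fa) (by
      rw [LinearMap.sub_comp, LinearMap.smul_comp, LinearMap.smul_comp, hfa, hfc]; module)
    obtain ⟨qbc, hqbc⟩ := hker (b • fc - c • fb) (by
      rw [LinearMap.sub_comp, LinearMap.smul_comp, LinearMap.smul_comp, hfb, hfc]; module)
    have hz : c • qab = a • (-qbc) + b • qac := by
      rw [← LinearMap.cancel_right hsurj]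
      simp only [LinearMap.add_comp, LinearMap.smul_comp, LinearMap.neg_comp, hqab, hqac, hqbc]
      module
    obtain ⟨s, hs, u, v, huv⟩ := exists_smul_eq_smul_add_smul_of_projective
      (M := Module.Dual R Q) hprime habc hz
    have hfg : a • (s • fb - u ∘ₗ β) = b • (s • fa + v ∘ₗ β) := by
      have := congrArg (· ∘ₗ β) huv
      simp only [LinearMap.add_comp, LinearMap.smul_comp, hqab] at this
      rw [← sub_eq_zero] at this ⊢
      rw [← this]
      module
    obtain ⟨t, ht, k, hk⟩ := Module.Dual.exists_smul_eq_smul hprime ha₀ hab hfg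
    refine hprime.mul_notMem ht hs ((hmem _).2 ⟨k, ?_⟩)
    refine smul_right_injective _ ha₀ ?_
    have hβα : β ∘ₗ α = 0 := hexact.linearMap_comp_eq_zero
    have := congrArg (· ∘ₗ α) hk
    simp only [LinearMap.add_comp, LinearMap.smul_comp, hfa, LinearMap.comp_assoc, hβα,
      LinearMap.comp_zero, add_zero] at this
    simp only [← this]
    module

/-- A linear map into which every functional extends is split, if its domain is finite
projective. -/
theorem LinearMap.exists_leftInverse_of_dualMap_surjective
    {R M N : Type*} [CommRing R] [AddCommGroup M] [Module R M] [AddCommGroup N] [Module R N]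
    [Module.Finite R M] [Module.Projective R M] {α : M →ₗ[R] N}
    (h : Function.Surjective α.dualMap) : ∃ ρ : N →ₗ[R] M, ρ ∘ₗ α = .id := by
  obtain ⟨n, f, g, -, -, hfg⟩ := Module.Finite.exists_comp_eq_id_of_projective R M
  choose e he using fun i ↦ h (LinearMap.proj i ∘ₗ g)
  refine ⟨f ∘ₗ LinearMap.pi e, ?_⟩
  have : LinearMap.pi e ∘ₗ α = g :=
    LinearMap.ext fun m ↦ funext fun i ↦ LinearMap.congr_fun (he i) m
  rw [LinearMap.comp_assoc, this, hfg]

theorem stmt_3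
    (R : Type*) [CommRing R] [IsDomain R] [IsNoetherianRing R]
    (hCM : IsCohenMacaulayRing R)
    (H F Q : Type*)
    [AddCommGroup H] [Module R H] [Module.Finite R H]
    [AddCommGroup F] [Module R F] [Module.Finite R F]
    [AddCommGroup Q] [Module R Q] [Module.Finite R Q]
    (α : H →ₗ[R] F) (β : F →ₗ[R] Q)
    (hinj : Function.Injective α) (hsurj : Function.Surjective β)
    (hexact : Function.Exact α β)
    [Module.IsReflexive R F]
    [Module.Projective R H]
    [Module.Projective R (Module.Dual R (Module.Dual R Q))]
    (hQcodim2 : ∀ p : PrimeSpectrum R, Order.height p ≤ 2 →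
      Module.Free (Localization.AtPrime p.asIdeal)
        (LocalizedModule p.asIdeal.primeCompl Q)) :
    Module.Projective R F ∧ Module.Projective R Q := by
  have : Module.Projective R (Module.Dual R Q) := Module.Dual.projective_of_projective_dual_dual
  obtain ⟨ρ, hρ⟩ := LinearMap.exists_leftInverse_of_dualMap_surjective
    (hCM.dualMap_surjective hinj hsurj hexact hQcodim2)
  obtain ⟨-, σ, hσ⟩ : Function.Injective α ∧ ∃ l, β ∘ₗ l = .id :=
    (hexact.split_tfae'.out 1 0 rfl rfl).mp ⟨hsurj, ρ, hρ⟩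
  have : Module.IsReflexive R Q := .of_split σ β hσ
  have hQ : Module.Projective R Q := .of_equiv (Module.evalEquiv R Q).symm
  obtain ⟨e, -⟩ : ∃ e : F ≃ₗ[R] H × Q, α = e.symm ∘ₗ LinearMap.inl R H Q ∧
      β = LinearMap.snd R H Q ∘ₗ e :=
    (hexact.split_tfae'.out 1 2 rfl rfl).mp ⟨hsurj, ρ, hρ⟩
  exact ⟨.of_equiv e.symm, hQ⟩
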